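/- arXiv:2012.02414 — 2 statements merged into one kernel-verified Lean document; each statement's English description precedes it below -/
import Mathlib

section
/- Let d ≥ 1 and let H be a set of Lipschitz maps from ℝ^d to ℝ^d that is a sup-universal approximator for the set Lip(ℝ^d) of all Lipschitz maps from ℝ^d to ℝ^d. Then the model class INN(H) := { W ∘ φ_{f_k}(·,1) ∘ ⋯ ∘ φ_{f_1}(·,1) : k ∈ ℕ, f_1, …, f_k ∈ H, W an invertible affine map of ℝ^d } is a sup-universal approximator for the class D² of all C²-diffeomorphisms F : U_F → Im(F) ⊂ ℝ^d whose domain U_F ⊂ ℝ^d is open and C²-diffeomorphic to ℝ^d. -/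
open scoped ContDiff

noncomputable section

abbrev Euc (d : ℕ) := EuclideanSpace ℝ (Fin d)

/-- `φ` is the global flow of the vector field `f`. -/
def IsFlow {E : Type*} [NormedAddCommGroup E] [NormedSpace ℝ E]
    (f : E → E) (φ : E → ℝ → E) : Prop :=
  ∀ x, φ x 0 = x ∧ ∀ t : ℝ, HasDerivAt (φ x) (f (φ x t)) t

/-- `iterComp k ψ = ψ (k-1) ∘ ⋯ ∘ ψ 0`. -/
def iterComp {E : Type*} : ∀ k : ℕ, (Fin k → E → E) → E → E
  | 0, _ => id
  | k + 1, ψ => iterComp k (fun i => ψ i.succ) ∘ ψ 0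

/-- `F` restricts to a `C^r`-diffeomorphism from the open set `U` onto the open set `V`. -/
def IsCrDiffeoOn (d : ℕ) (r : ℕ∞) (F : Euc d → Euc d) (U V : Set (Euc d)) : Prop :=
  IsOpen U ∧ IsOpen V ∧ F '' U = V ∧ ContDiffOn ℝ (r : WithTop ℕ∞) F U ∧
  ∃ G : Euc d → Euc d, ContDiffOn ℝ (r : WithTop ℕ∞) G V ∧ Set.InvOn G F U V


section Flow

open Set Filter Topology Metric
open scoped NNReal

variable {E : Type*} [NormedAddCommGroup E] [NormedSpace ℝ E]

/-- A globally Lipschitz vector field has integral curves defined on a time interval whose length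
does not depend on the initial point. -/
lemma LipschitzWith.exists_integralCurve_Ioo_uniform [CompleteSpace E] {f : E → E} {C : ℝ≥0}
    (hf : LipschitzWith C f) :
    ∃ h : ℝ, 0 < h ∧ ∀ x : E, ∃ α : ℝ → E, α 0 = x ∧
      ∀ t ∈ Ioo (-h) h, HasDerivAt α (f (α t)) t := by
  set h : ℝ≥0 := (2 * (C + 1))⁻¹ with hh
  have hpos : 0 < h := by positivity
  have hC : (h : ℝ) * C ≤ 1 / 2 := by
    have : (h : ℝ) * (2 * (C + 1)) = 1 := by
      rw [hh]; push_cast; field_simp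
    have := h.coe_nonneg
    nlinarith
  refine ⟨h, hpos, fun x ↦ ?_⟩
  set a : ℝ≥0 := 2 * h * ‖f x‖₊ with ha
  have hpl : IsPicardLindelof (fun _ ↦ f) (tmin := -(h : ℝ)) (tmax := h)
      ⟨0, by simp⟩ x a 0 (‖f x‖₊ + C * a) C := by
    refine IsPicardLindelof.of_time_independent (fun y hy ↦ ?_) hf.lipschitzOnWith ?_
    · have h1 := hf.dist_le_mul y x
      have h2 : (C : ℝ) * dist y x ≤ C * a := by gcongr; exact hy
      have h3 := norm_le_norm_add_norm_sub' (f y) (f x)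
      rw [dist_eq_norm] at h1
      push_cast
      linarith
    · simp only [sub_zero, zero_sub, neg_neg, max_self, NNReal.coe_zero]
      rw [ha]
      push_cast
      have := norm_nonneg (f x)
      have := mul_nonneg h.coe_nonneg this
      nlinarith
  obtain ⟨α, hα0, hα⟩ := hpl.exists_eq_forall_mem_Icc_hasDerivWithinAt₀
  exact ⟨α, hα0, fun t ht ↦
    (hα t (Ioo_subset_Icc_self ht)).hasDerivAt (Icc_mem_nhds ht.1 ht.2)⟩

lemma LipschitzWith.eqOn_integralCurve_Ioo {f : E → E} {C : ℝ≥0} (hf : LipschitzWith C f)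
    {α β : ℝ → E} {a b t₀ : ℝ} (ht₀ : t₀ ∈ Ioo a b)
    (hα : ∀ t ∈ Ioo a b, HasDerivAt α (f (α t)) t)
    (hβ : ∀ t ∈ Ioo a b, HasDerivAt β (f (β t)) t) (h0 : α t₀ = β t₀) : EqOn α β (Ioo a b) :=
  ODE_solution_unique_of_mem_Ioo (v := fun _ ↦ f) (s := fun _ ↦ univ) (K := C)
    (fun _ _ ↦ hf.lipschitzOnWith) ht₀ (fun t ht ↦ ⟨hα t ht, trivial⟩)
    (fun t ht ↦ ⟨hβ t ht, trivial⟩) h0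

lemma LipschitzWith.exists_integralCurve_Ioo_extend {f : E → E} {C : ℝ≥0}
    (hf : LipschitzWith C f) {T : ℝ} (hT : 0 < T)
    (h : ∀ x : E, ∃ α : ℝ → E, α 0 = x ∧ ∀ t ∈ Ioo (-T) T, HasDerivAt α (f (α t)) t) (x : E) :
    ∃ α : ℝ → E, α 0 = x ∧
      ∀ t ∈ Ioo (-(3 / 2 * T)) (3 / 2 * T), HasDerivAt α (f (α t)) t := by
  obtain ⟨α, hα0, hα⟩ := h x
  obtain ⟨β, hβ0, hβ⟩ := h (α (T / 2))
  obtain ⟨γ, hγ0, hγ⟩ := h (α (-(T / 2)))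
  have hβ' : ∀ t ∈ Ioo (-(T / 2)) (3 / 2 * T),
      HasDerivAt (fun s ↦ β (s - T / 2)) (f (β (t - T / 2))) t := fun t ht ↦
    (hβ (t - T / 2) ⟨by linarith [ht.1], by linarith [ht.2]⟩).comp_sub_const t (T / 2)
  have hγ' : ∀ t ∈ Ioo (-(3 / 2 * T)) (T / 2),
      HasDerivAt (fun s ↦ γ (s + T / 2)) (f (γ (t + T / 2))) t := fun t ht ↦
    (hγ (t + T / 2) ⟨by linarith [ht.1], by linarith [ht.2]⟩).comp_add_const t (T / 2)
  have hαβ : EqOn α (fun s ↦ β (s - T / 2)) (Ioo (-(T / 2)) T) :=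
    hf.eqOn_integralCurve_Ioo (t₀ := T / 2) ⟨by linarith, by linarith⟩
      (fun t ht ↦ hα t ⟨by linarith [ht.1], ht.2⟩)
      (fun t ht ↦ hβ' t ⟨ht.1, by linarith [ht.2]⟩) (by simp [hβ0])
  have hαγ : EqOn α (fun s ↦ γ (s + T / 2)) (Ioo (-T) (T / 2)) :=
    hf.eqOn_integralCurve_Ioo (t₀ := -(T / 2)) ⟨by linarith, by linarith⟩
      (fun t ht ↦ hα t ⟨ht.1, by linarith [ht.2]⟩)
      (fun t ht ↦ hγ' t ⟨by linarith [ht.1], ht.2⟩) (by simp [hγ0])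
  set δ : ℝ → E := fun t ↦ if t ≤ -(3 / 4 * T) then γ (t + T / 2)
    else if t < 3 / 4 * T then α t else β (t - T / 2) with hδ
  have key : ∀ {η : ℝ → E} {a b : ℝ}, EqOn δ η (Ioo a b) →
      (∀ t ∈ Ioo a b, HasDerivAt η (f (η t)) t) → ∀ t ∈ Ioo a b, HasDerivAt δ (f (δ t)) t := by
    intro η a b heq hη t ht
    rw [heq ht]
    exact (hη t ht).congr_of_eventuallyEq (heq.eventuallyEq_of_mem (Ioo_mem_nhds ht.1 ht.2))
  have e1 : EqOn δ α (Ioo (-T) T) := by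
    intro t ht
    simp only [hδ]
    split_ifs with h1 h2
    · exact (hαγ ⟨ht.1, by linarith⟩).symm
    · rfl
    · exact (hαβ ⟨by linarith, ht.2⟩).symm
  have e2 : EqOn δ (fun s ↦ β (s - T / 2)) (Ioo (T / 2) (3 / 2 * T)) := by
    intro t ht
    simp only [hδ]
    split_ifs with h1 h2
    · linarith [ht.1]
    · exact hαβ ⟨by linarith [ht.1], by linarith⟩
    · rfl
  have e3 : EqOn δ (fun s ↦ γ (s + T / 2)) (Ioo (-(3 / 2 * T)) (-(T / 2))) := by
    intro t ht
    simp only [hδ]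
    split_ifs with h1 h2
    · rfl
    · exact hαγ ⟨by linarith, by linarith [ht.2]⟩
    · linarith [ht.2]
  refine ⟨δ, by rw [e1 ⟨by linarith, hT⟩, hα0], fun t ht ↦ ?_⟩
  by_cases h1 : t < T
  · by_cases h2 : -T < t
    · exact key e1 hα t ⟨h2, h1⟩
    · exact key e3 (fun s hs ↦ hγ' s ⟨hs.1, by linarith [hs.2]⟩) t
        ⟨ht.1, by linarith⟩
  · exact key e2 (fun s hs ↦ hβ' s ⟨by linarith [hs.1], hs.2⟩) t ⟨by linarith, ht.2⟩

/-- A globally Lipschitz vector field on a Banach space has a global flow. -/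
theorem LipschitzWith.exists_isFlow [CompleteSpace E] {f : E → E} {C : ℝ≥0}
    (hf : LipschitzWith C f) : ∃ φ : E → ℝ → E, IsFlow f φ := by
  obtain ⟨h, hpos, hloc⟩ := hf.exists_integralCurve_Ioo_uniform
  have hstep : ∀ n : ℕ, ∀ x : E, ∃ α : ℝ → E, α 0 = x ∧
      ∀ t ∈ Ioo (-((3 / 2 : ℝ) ^ n * h)) ((3 / 2 : ℝ) ^ n * h), HasDerivAt α (f (α t)) t := by
    intro n
    induction n with
    | zero => simpa using hloc
    | succ n ih =>
      intro x
      have := hf.exists_integralCurve_Ioo_extend (T := (3 / 2 : ℝ) ^ n * h) (by positivity) ih x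
      rwa [← mul_assoc, ← pow_succ'] at this
  have hall : ∀ x : E, ∀ T : ℝ, ∃ α : ℝ → E, α 0 = x ∧
      ∀ t ∈ Ioo (-T) T, HasDerivAt α (f (α t)) t := by
    intro x T
    obtain ⟨n, hn⟩ := pow_unbounded_of_one_lt (T / h) (show (1 : ℝ) < 3 / 2 by norm_num)
    rw [div_lt_iff₀ hpos] at hn
    obtain ⟨α, hα0, hα⟩ := hstep n x
    exact ⟨α, hα0, fun t ht ↦ hα t ⟨by linarith [ht.1], by linarith [ht.2]⟩⟩
  choose α hα0 hα using hall
  refine ⟨fun x t ↦ α x (|t| + 1) t, fun x ↦ ⟨hα0 _ _, fun t ↦ ?_⟩⟩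
  have hagree : ∀ S T t : ℝ, |t| < S → S ≤ T → α x S t = α x T t := by
    intro S T t ht hST
    have hS : 0 < S := (abs_nonneg t).trans_lt ht
    refine hf.eqOn_integralCurve_Ioo (t₀ := 0) ⟨by linarith, hS⟩ (hα x S)
      (fun s hs ↦ hα x T s ⟨by linarith [hs.1], by linarith [hs.2]⟩) (by rw [hα0, hα0])
      (abs_lt.mp ht)
  have hev : (fun s ↦ α x (|s| + 1) s) =ᶠ[𝓝 t] α x (|t| + 2) := by
    have : ∀ᶠ s in 𝓝 t, |s| < |t| + 1 :=
      continuous_abs.continuousAt.eventually (gt_mem_nhds (by linarith))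
    filter_upwards [this] with s hs
    exact hagree _ _ _ (by linarith) (by linarith)
  change HasDerivAt (fun s ↦ α x (|s| + 1) s) (f (α x (|t| + 1) t)) t
  rw [show α x (|t| + 1) t = α x (|t| + 2) t from hev.eq_of_nhds]
  exact (hα x (|t| + 2) t (abs_lt.mp (by linarith))).congr_of_eventuallyEq hev

lemma IsFlow.continuous {f : E → E} {φ : E → ℝ → E} (h : IsFlow f φ) (x : E) :
    Continuous (φ x) :=
  continuous_iff_continuousAt.mpr fun t ↦ ((h x).2 t).continuousAt

lemma IsFlow.dist_le {f : E → E} {φ : E → ℝ → E} {C : ℝ≥0} (h : IsFlow f φ)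
    (hf : LipschitzWith C f) (x y : E) {t : ℝ} (ht : 0 ≤ t) :
    dist (φ x t) (φ y t) ≤ dist x y * Real.exp (C * t) := by
  have := dist_le_of_trajectories_ODE (v := fun _ ↦ f) (K := C) (a := 0) (b := t)
    (f := φ x) (g := φ y) (δ := dist x y) (fun _ ↦ hf) (h.continuous x).continuousOn
    (fun s _ ↦ ((h x).2 s).hasDerivWithinAt) (h.continuous y).continuousOn
    (fun s _ ↦ ((h y).2 s).hasDerivWithinAt) (by rw [(h x).1, (h y).1]) t ⟨ht, le_rfl⟩
  simpa using this

lemma IsFlow.eq_of_hasDerivAt {f : E → E} {φ : E → ℝ → E} {C : ℝ≥0} (h : IsFlow f φ)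
    (hf : LipschitzWith C f) {z : ℝ → E} {b : ℝ} (hb : 0 ≤ b)
    (hz : ∀ t ∈ Icc 0 b, HasDerivAt z (f (z t)) t) : φ (z 0) b = z b :=
  ODE_solution_unique (v := fun _ ↦ f) (K := C) (a := 0) (b := b) (fun _ ↦ hf)
    (h.continuous _).continuousOn (fun s _ ↦ ((h _).2 s).hasDerivWithinAt)
    (fun s hs ↦ (hz s hs).continuousAt.continuousWithinAt)
    (fun s hs ↦ (hz s (Ico_subset_Icc_self hs)).hasDerivWithinAt) (h _).1 ⟨hb, le_rfl⟩

/-- Stability of integral curves: if `g` is close to the Lipschitz field `f` on a ball containing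
the unit neighbourhood of an integral curve of `f`, its own integral curve stays close. -/
lemma IsFlow.dist_le_gronwallBound {f g : E → E} {φ γ : E → ℝ → E} {C : ℝ≥0}
    (hφ : IsFlow f φ) (hf : LipschitzWith C f) (hγ : IsFlow g γ) {x : E} {ρ δ : ℝ}
    (hρ : ∀ t ∈ Icc (0 : ℝ) 1, ‖φ x t‖ ≤ ρ)
    (hfg : ∀ y ∈ closedBall (0 : E) (ρ + 1), ‖f y - g y‖ < δ) (hδ : 0 ≤ δ)
    (hsmall : gronwallBound 0 C δ 1 < 1) :
    dist (γ x 1) (φ x 1) ≤ gronwallBound 0 C δ 1 := by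
  have hgr : ∀ b ∈ Icc (0 : ℝ) 1, (∀ t ∈ Ico 0 b, dist (γ x t) (φ x t) < 1) →
      dist (γ x b) (φ x b) ≤ gronwallBound 0 C δ 1 := by
    intro b hb hlt
    have := dist_le_of_approx_trajectories_ODE (v := fun _ ↦ f) (K := C) (a := 0) (b := b)
      (f := γ x) (g := φ x) (δ := 0) (εf := δ) (εg := 0) (fun _ ↦ hf)
      (hγ.continuous x).continuousOn (fun s _ ↦ ((hγ x).2 s).hasDerivWithinAt)
      (fun t ht ↦ by
        rw [dist_comm, dist_eq_norm]
        refine (hfg _ ?_).le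
        rw [mem_closedBall_zero_iff]
        have h1 := hlt t ht
        have h2 := hρ t ⟨ht.1, ht.2.le.trans hb.2⟩
        rw [dist_eq_norm] at h1
        linarith [norm_le_norm_add_norm_sub' (γ x t) (φ x t)])
      (hφ.continuous x).continuousOn (fun s _ ↦ ((hφ x).2 s).hasDerivWithinAt)
      (fun t _ ↦ (dist_self _).le) (by rw [(hγ x).1, (hφ x).1, dist_self]) b ⟨hb.1, le_rfl⟩
    rw [add_zero, sub_zero] at this
    exact this.trans (gronwallBound_mono le_rfl hδ C.coe_nonneg hb.2)
  by_cases hne : (Icc (0 : ℝ) 1 ∩ {t | 1 ≤ dist (γ x t) (φ x t)}).Nonempty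
  · exfalso
    have hcomp : IsCompact (Icc (0 : ℝ) 1 ∩ {t | 1 ≤ dist (γ x t) (φ x t)}) :=
      isCompact_Icc.inter_right
        (isClosed_le continuous_const ((hγ.continuous x).dist (hφ.continuous x)))
    obtain ⟨b, hb, hmin⟩ := hcomp.exists_isLeast hne
    have h1 := hgr b hb.1 fun t ht ↦ by
      by_contra! hcon
      exact absurd (hmin ⟨⟨ht.1, ht.2.le.trans hb.1.2⟩, hcon⟩) (not_le.mpr ht.2)
    have h2 : 1 ≤ dist (γ x b) (φ x b) := hb.2
    linarith
  · refine hgr 1 (by simp) fun t ht ↦ ?_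
    by_contra! hcon
    exact hne ⟨t, Ico_subset_Icc_self ht, hcon⟩

/-- If `H` approximates all Lipschitz maps uniformly on compact sets, the time-one maps of fields
in `H` approximate the time-one map of every Lipschitz field uniformly on compact sets. -/
lemma exists_isFlow_approx [FiniteDimensional ℝ E] {H : Set (E → E)}
    (hH : ∀ f ∈ H, ∃ C : ℝ≥0, LipschitzWith C f)
    (huniv : ∀ F : E → E, (∃ C : ℝ≥0, LipschitzWith C F) →
      ∀ K : Set E, IsCompact K → ∀ ε : ℝ, 0 < ε → ∃ g ∈ H, ∀ x ∈ K, ‖F x - g x‖ < ε)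
    {f : E → E} {φ : E → ℝ → E} {C : ℝ≥0} (hφ : IsFlow f φ) (hf : LipschitzWith C f)
    {K : Set E} (hK : IsCompact K) {ε : ℝ} (hε : 0 < ε) :
    ∃ g ∈ H, ∃ γ, IsFlow g γ ∧ ∀ x ∈ K, dist (γ x 1) (φ x 1) < ε := by
  have : CompleteSpace E := FiniteDimensional.complete ℝ E
  have : ProperSpace E := FiniteDimensional.proper ℝ E
  obtain ⟨R, hR⟩ := hK.isBounded.subset_closedBall (0 : E)
  obtain ⟨S, hS⟩ := (isCompact_Icc (a := (0 : ℝ)) (b := 1)).exists_bound_of_continuousOn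
    (hφ.continuous 0).continuousOn
  have hρ : ∀ x ∈ K, ∀ t ∈ Icc (0 : ℝ) 1, ‖φ x t‖ ≤ S + R * Real.exp C := by
    intro x hx t ht
    have h1 := hφ.dist_le hf x 0 ht.1
    have h2 : dist x 0 ≤ R := hR hx
    have h3 : dist x 0 * Real.exp (C * t) ≤ R * Real.exp C := by
      gcongr
      · exact dist_nonneg.trans h2
      · exact mul_le_of_le_one_right C.coe_nonneg ht.2
    have h4 := hS t ht
    rw [dist_eq_norm] at h1
    linarith [norm_le_norm_add_norm_sub' (φ x t) (φ 0 t)]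
  have hlim : Tendsto (fun δ ↦ gronwallBound 0 C δ 1) (𝓝[>] 0) (𝓝 0) := by
    have := (gronwallBound_continuous_ε 0 C 1).tendsto 0
    rw [gronwallBound_ε0_δ0] at this
    exact this.mono_left nhdsWithin_le_nhds
  obtain ⟨δ, hδ, hδpos⟩ := ((hlim.eventually (gt_mem_nhds (lt_min one_pos hε))).and
    self_mem_nhdsWithin).exists
  have hδpos : 0 < δ := hδpos
  obtain ⟨g, hg, hfg⟩ := huniv f ⟨C, hf⟩ (closedBall 0 (S + R * Real.exp C + 1))
    (isCompact_closedBall _ _) δ hδpos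
  obtain ⟨Cg, hCg⟩ := hH g hg
  obtain ⟨γ, hγ⟩ := hCg.exists_isFlow
  exact ⟨g, hg, γ, hγ, fun x hx ↦ (hφ.dist_le_gronwallBound hf hγ (hρ x hx) hfg hδpos.le
    (hδ.trans_le (min_le_left _ _))).trans_lt (hδ.trans_le (min_le_right _ _))⟩

lemma exists_isFlow_comp_approx [FiniteDimensional ℝ E] {H : Set (E → E)}
    (hH : ∀ f ∈ H, ∃ C : ℝ≥0, LipschitzWith C f)
    (huniv : ∀ F : E → E, (∃ C : ℝ≥0, LipschitzWith C F) →
      ∀ K : Set E, IsCompact K → ∀ ε : ℝ, 0 < ε → ∃ g ∈ H, ∀ x ∈ K, ‖F x - g x‖ < ε)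
    {f₁ f₂ : E → E} {φ₁ φ₂ : E → ℝ → E} {C₁ C₂ : ℝ≥0} (hφ₁ : IsFlow f₁ φ₁) (hφ₂ : IsFlow f₂ φ₂)
    (hf₁ : LipschitzWith C₁ f₁) (hf₂ : LipschitzWith C₂ f₂)
    {K : Set E} (hK : IsCompact K) {ε : ℝ} (hε : 0 < ε) :
    ∃ g₁ ∈ H, ∃ g₂ ∈ H, ∃ γ₁ γ₂, IsFlow g₁ γ₁ ∧ IsFlow g₂ γ₂ ∧
      ∀ x ∈ K, dist (γ₂ (γ₁ x 1) 1) (φ₂ (φ₁ x 1) 1) < ε := by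
  have : ProperSpace E := FiniteDimensional.proper ℝ E
  have hcont : Continuous fun x ↦ φ₁ x 1 := by
    refine (LipschitzWith.of_dist_le_mul (K := (Real.exp C₁).toNNReal) fun x y ↦ ?_).continuous
    rw [Real.coe_toNNReal _ (Real.exp_pos _).le, mul_comm]
    simpa using hφ₁.dist_le hf₁ x y zero_le_one
  obtain ⟨g₁, hg₁, γ₁, hγ₁, h₁⟩ := exists_isFlow_approx hH huniv hφ₁ hf₁ hK
    (ε := min 1 (ε / 2 / Real.exp C₂)) (by positivity)
  obtain ⟨g₂, hg₂, γ₂, hγ₂, h₂⟩ := exists_isFlow_approx hH huniv hφ₂ hf₂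
    ((hK.image hcont).cthickening (r := 1)) (half_pos hε)
  refine ⟨g₁, hg₁, g₂, hg₂, γ₁, γ₂, hγ₁, hγ₂, fun x hx ↦ ?_⟩
  have hx₁ := h₁ x hx
  have ha := h₂ (γ₁ x 1) (mem_cthickening_of_dist_le _ _ _ _ (mem_image_of_mem _ hx)
    (hx₁.le.trans (min_le_left _ _)))
  have hb := hφ₂.dist_le hf₂ (γ₁ x 1) (φ₁ x 1) zero_le_one
  have hc : dist (γ₁ x 1) (φ₁ x 1) * Real.exp C₂ < ε / 2 := by
    rw [← lt_div_iff₀ (Real.exp_pos _)]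
    exact hx₁.trans_le (min_le_right _ _)
  rw [mul_one] at hb
  linarith [dist_triangle (γ₂ (γ₁ x 1) 1) (φ₂ (γ₁ x 1) 1) (φ₂ (φ₁ x 1) 1)]

end Flow

section Dilation

open Set Filter Topology Metric
open scoped NNReal

variable {E : Type*} [NormedAddCommGroup E] [NormedSpace ℝ E]

/-- The push-forward of the Euler field `x ↦ x` under a `C²` embedding `P` agrees on the image of a
ball with a globally Lipschitz field. -/
lemma exists_lipschitzWith_pushforward_euler [FiniteDimensional ℝ E] {P Q : E → E} {V : Set E} (hP : ContDiff ℝ 2 P)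
    (hV : IsOpen V) (hPV : ∀ x, P x ∈ V) (hQ : ContDiffOn ℝ 2 Q V) (hQP : ∀ x, Q (P x) = x)
    (R : ℝ) : ∃ (f : E → E) (C : ℝ≥0), LipschitzWith C f ∧
      ∀ x ∈ closedBall (0 : E) R, f (P x) = fderiv ℝ P x x := by
  have : ProperSpace E := FiniteDimensional.proper ℝ E
  have hB : IsCompact (closedBall (0 : E) R) := isCompact_closedBall _ _
  obtain ⟨C₁, hC₁⟩ := ((hP.fderiv_right (m := 1) (by norm_num)).clm_apply
    contDiff_id).contDiffOn.exists_lipschitzOnWith one_ne_zero (convex_closedBall (0 : E) R) hB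
  have hloc : LocallyLipschitzOn (P '' closedBall 0 R) Q := by
    rintro _ ⟨x, -, rfl⟩
    obtain ⟨C, t, ht, hC⟩ := ((hQ.contDiffAt (hV.mem_nhds (hPV x))).of_le
      one_le_two).exists_lipschitzOnWith
    exact ⟨C, t, mem_nhdsWithin_of_mem_nhds ht, hC⟩
  obtain ⟨C₂, hC₂⟩ := hloc.exists_lipschitzOnWith_of_compact (hB.image hP.continuous)
  obtain ⟨f, hf, hfeq⟩ := (hC₁.comp hC₂ (by
    rintro _ ⟨x, hx, rfl⟩
    rwa [hQP])).extend_finite_dimension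
  refine ⟨f, _, hf, fun x hx ↦ ?_⟩
  rw [← hfeq (mem_image_of_mem P hx)]
  simp [hQP]

/-- The flow of the push-forward of the Euler field is conjugate to dilations. -/
lemma IsFlow.pushforward_euler {P f : E → E} {C : ℝ≥0} {R T : ℝ} (hP : ContDiff ℝ 2 P)
    (hf : LipschitzWith C f)
    (hfP : ∀ x ∈ closedBall (0 : E) R, f (P x) = fderiv ℝ P x x) {φ : E → ℝ → E}
    (hφ : IsFlow (fun y ↦ T • f y) φ) {x : E}
    (hx : ∀ s ∈ Icc (0 : ℝ) 1, Real.exp (T * s) • x ∈ closedBall (0 : E) R) :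
    φ (P x) 1 = P (Real.exp T • x) := by
  have hTf : LipschitzWith (‖T‖₊ * C) fun y ↦ T • f y := (lipschitzWith_smul T).comp hf
  have := hφ.eq_of_hasDerivAt hTf (z := fun s ↦ P (Real.exp (T * s) • x)) zero_le_one
    fun s hs ↦ by
      have h1 : HasDerivAt (fun s ↦ Real.exp (T * s) • x) ((Real.exp (T * s) * T) • x) s := by
        have := ((hasDerivAt_id s).const_mul T).exp.smul_const x
        simpa using this
      have h2 := ((hP.differentiable two_ne_zero _).hasFDerivAt (x := Real.exp (T * s) • x)
        ).comp_hasDerivAt s h1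
      rw [hfP _ (hx s hs)]
      rwa [mul_comm (Real.exp _) T, mul_smul, map_smul] at h2
  simpa using this

/-- If `κ 0 = 0` and `κ` has derivative the identity at `0`, then the rescaled maps
`e ^ T • κ (e ^ (-T) • v)` converge to `v` uniformly on balls. -/
lemma eventually_dist_exp_smul_lt {κ : E → E} (h0 : κ 0 = 0)
    (hκ : HasFDerivAt κ (ContinuousLinearMap.id ℝ E) 0) (R : ℝ) {η : ℝ} (hη : 0 < η) :
    ∀ᶠ T in (atTop : Filter ℝ), ∀ v ∈ closedBall (0 : E) R,
      dist (Real.exp T • κ (Real.exp (-T) • v)) v < η := by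
  have hc : 0 < η / (|R| + 1) := by positivity
  have hlo := hκ.isLittleO.def hc
  simp only [h0, sub_zero, ContinuousLinearMap.coe_id', id_eq] at hlo
  obtain ⟨r, hr, hball⟩ := Metric.eventually_nhds_iff_ball.mp hlo
  have hlim : Tendsto (fun T : ℝ ↦ Real.exp (-T) * (|R| + 1)) atTop (𝓝 0) := by
    simpa using Real.tendsto_exp_neg_atTop_nhds_zero.mul_const (|R| + 1)
  filter_upwards [hlim.eventually (gt_mem_nhds hr)] with T hT v hv
  have hv' : ‖v‖ < |R| + 1 := by
    rw [mem_closedBall_zero_iff] at hv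
    linarith [le_abs_self R]
  have hn : ‖Real.exp (-T) • v‖ = Real.exp (-T) * ‖v‖ := by
    rw [norm_smul, Real.norm_of_nonneg (Real.exp_pos _).le]
  have h1 := hball (Real.exp (-T) • v) (by
    rw [mem_ball_zero_iff, hn]
    exact (mul_le_mul_of_nonneg_left hv'.le (Real.exp_pos _).le).trans_lt hT)
  have hee : Real.exp T * Real.exp (-T) = 1 := by rw [← Real.exp_add]; simp
  have h2 : Real.exp T • κ (Real.exp (-T) • v) - v =
      Real.exp T • (κ (Real.exp (-T) • v) - Real.exp (-T) • v) := by
    rw [smul_sub, smul_smul, hee, one_smul]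
  rw [dist_eq_norm, h2, norm_smul, Real.norm_of_nonneg (Real.exp_pos _).le]
  calc Real.exp T * ‖κ (Real.exp (-T) • v) - Real.exp (-T) • v‖
      ≤ Real.exp T * (η / (|R| + 1) * (Real.exp (-T) * ‖v‖)) := by
        rw [← hn]; gcongr
    _ = (Real.exp T * Real.exp (-T)) * (η / (|R| + 1) * ‖v‖) := by ring
    _ = η / (|R| + 1) * ‖v‖ := by rw [hee, one_mul]
    _ < η / (|R| + 1) * (|R| + 1) := by gcongr
    _ = η := by field_simp

/-- The derivative of a `C²` embedding as a linear equivalence. -/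
lemma exists_linearEquiv_fderiv [FiniteDimensional ℝ E] {P Q : E → E} {V : Set E} (hP : ContDiff ℝ 2 P)
    (hV : IsOpen V) (hPV : ∀ x, P x ∈ V) (hQ : ContDiffOn ℝ 2 Q V) (hQP : ∀ x, Q (P x) = x)
    (x : E) : ∃ A : E ≃L[ℝ] E, HasFDerivAt P (A : E →L[ℝ] E) x ∧
      HasFDerivAt Q (A.symm : E →L[ℝ] E) (P x) := by
  have h1 := (hP.differentiable two_ne_zero x).hasFDerivAt
  have h2 := ((hQ.contDiffAt (hV.mem_nhds (hPV x))).differentiableAt two_ne_zero).hasFDerivAt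
  have hid : (fderiv ℝ Q (P x)).comp (fderiv ℝ P x) = ContinuousLinearMap.id ℝ E := by
    refine (h2.comp x h1).unique ?_
    rw [show Q ∘ P = id from funext hQP]
    exact hasFDerivAt_id x
  have hleft : ∀ v, fderiv ℝ Q (P x) (fderiv ℝ P x v) = v := fun v ↦ DFunLike.congr_fun hid v
  let A := (LinearEquiv.ofInjectiveEndo (fderiv ℝ P x : E →ₗ[ℝ] E)
    (Function.LeftInverse.injective hleft)).toContinuousLinearEquiv
  have hA : (A : E →L[ℝ] E) = fderiv ℝ P x := by ext v; rfl
  have hA' : (A.symm : E →L[ℝ] E) = fderiv ℝ Q (P x) := by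
    ext v
    obtain ⟨w, rfl⟩ := A.surjective v
    have : A w = fderiv ℝ P x w := rfl
    rw [ContinuousLinearEquiv.coe_coe, A.symm_apply_apply, this, hleft]
  exact ⟨A, hA ▸ h1, hA' ▸ h2⟩

/-- Two `C²` embeddings `P`, `G` of `E` differ on a compact set, up to a small error, by two flows
of Lipschitz fields and an affine isomorphism. -/
lemma exists_isFlow_affine_approx [FiniteDimensional ℝ E] {P Q G S : E → E} {U V : Set E}
    (hP : ContDiff ℝ 2 P) (hU : IsOpen U) (hPU : ∀ x, P x ∈ U) (hQ : ContDiffOn ℝ 2 Q U)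
    (hQP : ∀ x, Q (P x) = x)
    (hG : ContDiff ℝ 2 G) (hV : IsOpen V) (hGV : ∀ x, G x ∈ V) (hS : ContDiffOn ℝ 2 S V)
    (hSG : ∀ x, S (G x) = x) (hGS : ∀ y ∈ V, G (S y) = y)
    (R : ℝ) {ε : ℝ} (hε : 0 < ε) :
    ∃ (f₁ f₂ : E → E) (C₁ C₂ : ℝ≥0) (φ₁ φ₂ : E → ℝ → E) (W : E ≃ᵃ[ℝ] E),
      LipschitzWith C₁ f₁ ∧ LipschitzWith C₂ f₂ ∧ IsFlow f₁ φ₁ ∧ IsFlow f₂ φ₂ ∧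
      ∀ v ∈ closedBall (0 : E) R, dist (φ₂ (W (φ₁ (P v) 1)) 1) (G v) < ε := by
  have : CompleteSpace E := FiniteDimensional.complete ℝ E
  have : ProperSpace E := FiniteDimensional.proper ℝ E
  obtain ⟨f, C, hf, hfP⟩ := exists_lipschitzWith_pushforward_euler hP hU hPU hQ hQP R
  obtain ⟨g, D, hg, hgG⟩ := exists_lipschitzWith_pushforward_euler hG hV hGV hS hSG (R + 1)
  obtain ⟨A, -, hS'⟩ := exists_linearEquiv_fderiv hG hV hGV hS hSG 0
  obtain ⟨B, hB, -⟩ := exists_linearEquiv_fderiv hP hU hPU hQ hQP 0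
  let M : E ≃L[ℝ] E := B.symm.trans A
  let W : E ≃ᵃ[ℝ] E := M.toLinearEquiv.toAffineEquiv.trans
    (AffineEquiv.constVAdd ℝ E (G 0 - M (P 0)))
  have hW : ∀ y, W y = G 0 - M (P 0) + M y := fun y ↦ rfl
  have hW0 : W (P 0) = G 0 := by rw [hW]; abel
  have hWP : HasFDerivAt (fun x ↦ W (P x)) (A : E →L[ℝ] E) 0 := by
    have := (M.hasFDerivAt.comp 0 hB).const_add (G 0 - M (P 0))
    convert! this using 1
    ext v
    simp [M]
  have hκ : HasFDerivAt (fun x ↦ S (W (P x))) (ContinuousLinearMap.id ℝ E) 0 := by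
    have h1 : HasFDerivAt S (A.symm : E →L[ℝ] E) (W (P 0)) := by rwa [hW0]
    have := h1.comp 0 hWP
    convert! this using 1
    ext v
    simp
  have hVev : ∀ᶠ x in 𝓝 (0 : E), W (P x) ∈ V :=
    hWP.continuousAt.eventually (hV.mem_nhds (by simpa only [hW0] using hGV 0))
  obtain ⟨r, hr, hrV⟩ := Metric.eventually_nhds_iff_ball.mp hVev
  obtain ⟨δ, hδ, hGδ⟩ := Metric.uniformContinuousOn_iff.mp
    ((isCompact_closedBall (0 : E) (R + 1)).uniformContinuousOn_of_continuous
      hG.continuous.continuousOn) ε hε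
  have hlim : Tendsto (fun T : ℝ ↦ Real.exp (-T) * (|R| + 1)) atTop (𝓝 0) := by
    simpa using Real.tendsto_exp_neg_atTop_nhds_zero.mul_const (|R| + 1)
  obtain ⟨T, ⟨hT, hTr⟩, hT0⟩ := (((eventually_dist_exp_smul_lt
    (show S (W (P 0)) = 0 by rw [hW0, hSG]) hκ R (lt_min one_pos hδ)).and
    (hlim.eventually (gt_mem_nhds hr))).and (eventually_ge_atTop 0)).exists
  have hf' : LipschitzWith (‖-T‖₊ * C) fun y ↦ (-T) • f y := (lipschitzWith_smul (-T)).comp hf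
  have hg' : LipschitzWith (‖T‖₊ * D) fun y ↦ T • g y := (lipschitzWith_smul T).comp hg
  obtain ⟨φ₁, hφ₁⟩ := hf'.exists_isFlow
  obtain ⟨φ₂, hφ₂⟩ := hg'.exists_isFlow
  refine ⟨_, _, _, _, φ₁, φ₂, W, hf', hg', hφ₁, hφ₂, fun v hv ↦ ?_⟩
  have hv' : ‖v‖ ≤ R := mem_closedBall_zero_iff.mp hv
  have e1 : φ₁ (P v) 1 = P (Real.exp (-T) • v) :=
    IsFlow.pushforward_euler hP hf hfP hφ₁ fun s hs ↦ by
      rw [mem_closedBall_zero_iff, norm_smul, Real.norm_of_nonneg (Real.exp_pos _).le]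
      refine (mul_le_of_le_one_left (norm_nonneg v) (Real.exp_le_one_iff.mpr ?_)).trans hv'
      nlinarith [hs.1]
  set w := Real.exp (-T) • v with hw
  have hwV : W (P w) ∈ V := by
    refine hrV w ?_
    rw [mem_ball_zero_iff, hw, norm_smul, Real.norm_of_nonneg (Real.exp_pos _).le]
    refine lt_of_le_of_lt ?_ hTr
    gcongr
    linarith [le_abs_self R]
  have hd := hT v hv
  have hnorm : ‖Real.exp T • S (W (P w))‖ ≤ R + 1 := by
    have h1 := hd.trans_le (min_le_left _ _)
    rw [dist_eq_norm] at h1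
    linarith [norm_le_norm_add_norm_sub' (Real.exp T • S (W (P w))) v]
  have e2 : φ₂ (G (S (W (P w)))) 1 = G (Real.exp T • S (W (P w))) :=
    IsFlow.pushforward_euler hG hg hgG hφ₂ fun s hs ↦ by
      rw [mem_closedBall_zero_iff]
      refine le_trans ?_ hnorm
      rw [norm_smul, norm_smul, Real.norm_of_nonneg (Real.exp_pos _).le,
        Real.norm_of_nonneg (Real.exp_pos _).le]
      gcongr
      nlinarith [hs.2]
  rw [e1, ← hGS _ hwV, e2]
  exact hGδ _ (mem_closedBall_zero_iff.mpr hnorm) _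
    (closedBall_subset_closedBall (by linarith) hv) (hd.trans_le (min_le_right _ _))

/-- Conjugating a flow by an affine isomorphism gives the flow of the conjugated field. -/
lemma IsFlow.affine_conj [FiniteDimensional ℝ E] {f : E → E} {φ : E → ℝ → E} (hφ : IsFlow f φ) (W : E ≃ᵃ[ℝ] E) :
    IsFlow (fun y ↦ W.linear.symm (f (W y))) fun y t ↦ W.symm (φ (W y) t) := by
  refine fun x ↦ ⟨by simp [(hφ (W x)).1], fun t ↦ ?_⟩
  have h1 := (W.linear.symm.toContinuousLinearEquiv.hasFDerivAt (x := φ (W x) t)).comp_hasDerivAt t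
    ((hφ (W x)).2 t)
  have h2 : (fun s ↦ W.symm (φ (W x) s)) =
      fun s ↦ W.linear.symm (φ (W x) s) + W.symm 0 := by
    ext s
    have := W.symm.map_vadd 0 (φ (W x) s)
    simpa using this
  simpa [h2] using h1.add_const (W.symm 0)

lemma AffineEquiv.exists_lipschitzWith [FiniteDimensional ℝ E] (W : E ≃ᵃ[ℝ] E) : ∃ C : ℝ≥0, LipschitzWith C W := by
  refine ⟨_, LipschitzWith.of_dist_le_mul
    (K := ‖(W.linear.toContinuousLinearEquiv : E →L[ℝ] E)‖₊) fun x y ↦ ?_⟩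
  rw [dist_eq_norm, dist_eq_norm, ← vsub_eq_sub (W x),
    show W x -ᵥ W y = W.linear (x -ᵥ y) from (AffineMap.linearMap_vsub W.toAffineMap x y).symm]
  exact (W.linear.toContinuousLinearEquiv : E →L[ℝ] E).le_opNorm (x - y)

end Dilation

/-- The inverse of a diffeomorphism maps the target into the source. -/
lemma IsCrDiffeoOn.exists_inverse {d : ℕ} {r : ℕ∞} {F : Euc d → Euc d} {U V : Set (Euc d)}
    (h : IsCrDiffeoOn d r F U V) :
    ∃ G : Euc d → Euc d, ContDiffOn ℝ (r : WithTop ℕ∞) G V ∧ Set.InvOn G F U V ∧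
      Set.MapsTo G V U := by
  obtain ⟨-, -, rfl, -, G, hG, hinv⟩ := h
  refine ⟨G, hG, hinv, ?_⟩
  rintro _ ⟨x, hx, rfl⟩
  rwa [hinv.1 hx]

/-- if `H ⊆ Lip(ℝ^d)` is a sup-universal approximator for `Lip(ℝ^d)`,
then `INN(H)` is a sup-universal approximator for the class `D²` of `C²`-diffeomorphisms
whose (open) domain is `C²`-diffeomorphic to `ℝ^d`. -/
theorem sup_universality_of_NODE_INN
    (d : ℕ) (hd : 1 ≤ d) (H : Set (Euc d → Euc d))
    (hH : ∀ f ∈ H, ∃ C : NNReal, LipschitzWith C f)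
    (huniv : ∀ F : Euc d → Euc d, (∃ C : NNReal, LipschitzWith C F) →
      ∀ K : Set (Euc d), IsCompact K → ∀ ε : ℝ, 0 < ε →
        ∃ g ∈ H, ∀ x ∈ K, ‖F x - g x‖ < ε)
    -- `F : U → Im F` is a `C²`-diffeomorphism, `U` open and `C²`-diffeomorphic to `ℝ^d`
    (F : Euc d → Euc d) (U : Set (Euc d)) (hF : IsCrDiffeoOn d 2 F U (F '' U))
    (hU : ∃ ψ : Euc d → Euc d, IsCrDiffeoOn d 2 ψ U Set.univ)
    (K : Set (Euc d)) (hK : IsCompact K) (hKU : K ⊆ U)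
    (ε : ℝ) (hε : 0 < ε) :
    ∃ (k : ℕ), 1 ≤ k ∧ ∃ (f : Fin k → Euc d → Euc d) (φ : Fin k → Euc d → ℝ → Euc d)
      (W : Euc d ≃ᵃ[ℝ] Euc d),
      (∀ i, f i ∈ H) ∧ (∀ i, IsFlow (f i) (φ i)) ∧
      ∀ x ∈ K, ‖F x - W (iterComp k (fun i y => φ i y 1) x)‖ < ε := by
  have hF2 : ContDiffOn ℝ 2 F U := hF.2.2.2.1
  have hUo : IsOpen U := hF.1
  have hVo : IsOpen (F '' U) := hF.2.1
  obtain ⟨S, hS, hSF, hSU⟩ := hF.exists_inverse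
  obtain ⟨Q, hQ⟩ := hU
  have hQ2 : ContDiffOn ℝ 2 Q U := hQ.2.2.2.1
  obtain ⟨P, hP, hPQ, hPU⟩ := hQ.exists_inverse
  have hP2 : ContDiff ℝ 2 P := contDiffOn_univ.mp hP
  have hPU' : ∀ x, P x ∈ U := fun x ↦ hPU (Set.mem_univ x)
  have hQP : ∀ x, Q (P x) = x := fun x ↦ hPQ.2 (Set.mem_univ x)
  obtain ⟨R, hR⟩ := (hK.image_of_continuousOn
    (hQ2.continuousOn.mono hKU)).isBounded.subset_closedBall 0
  obtain ⟨f₁, f₂, C₁, C₂, φ₁, φ₂, W, hf₁, hf₂, hφ₁, hφ₂, happ⟩ :=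
    exists_isFlow_affine_approx hP2 hUo hPU' hQ2 hQP
      (hF2.comp_contDiff hP2 hPU') hVo (fun x ↦ Set.mem_image_of_mem F (hPU' x))
      (S := Q ∘ S) (hQ2.comp hS hSU)
      (fun x ↦ by rw [Function.comp_apply, Function.comp_apply, hSF.1 (hPU' x), hQP])
      (fun y hy ↦ by rw [Function.comp_apply, Function.comp_apply, hPQ.1 (hSU hy), hSF.2 hy])
      R (half_pos hε)
  obtain ⟨A, hA⟩ := W.exists_lipschitzWith
  have hlin : LipschitzWith ‖(W.linear.symm.toContinuousLinearEquiv : Euc d →L[ℝ] Euc d)‖₊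
      W.linear.symm :=
    (W.linear.symm.toContinuousLinearEquiv : Euc d →L[ℝ] Euc d).lipschitz
  obtain ⟨g₁, hg₁, g₂, hg₂, γ₁, γ₂, hγ₁, hγ₂, hγ⟩ := exists_isFlow_comp_approx hH huniv
    hφ₁ (hφ₂.affine_conj W) hf₁ (hlin.comp (hf₂.comp hA)) hK
    (ε := ε / 2 / (A + 1)) (by positivity)
  refine ⟨2, one_le_two, ![g₁, g₂], ![γ₁, γ₂], W, ?_, ?_, fun x hx ↦ ?_⟩
  · simp [Fin.forall_fin_two, hg₁, hg₂]
  · simp [Fin.forall_fin_two, hγ₁, hγ₂]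
  have hPx : P (Q x) = x := hPQ.1 (hKU hx)
  have h1 := happ (Q x) (hR (Set.mem_image_of_mem Q hx))
  rw [Function.comp_apply, hPx] at h1
  have h2 := hA.dist_le_mul (γ₂ (γ₁ x 1) 1) (W.symm (φ₂ (W (φ₁ x 1)) 1))
  rw [W.apply_symm_apply] at h2
  have h3 : (A : ℝ) * dist (γ₂ (γ₁ x 1) 1) (W.symm (φ₂ (W (φ₁ x 1)) 1)) ≤ ε / 2 := by
    have h4 := (hγ x hx).le
    rw [le_div_iff₀ (by positivity)] at h4
    nlinarith [dist_nonneg (x := γ₂ (γ₁ x 1) 1) (y := W.symm (φ₂ (W (φ₁ x 1)) 1))]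
  change ‖F x - W (γ₂ (γ₁ x 1) 1)‖ < ε
  rw [← dist_eq_norm, dist_comm]
  linarith [dist_triangle (W (γ₂ (γ₁ x 1) 1)) (φ₂ (W (φ₁ x 1)) 1) (F x)]
end
end

section
/- Define h : (0,1) → ℝ by h(x) := ∑_{k=1}^∞ x^{1/k − 1} / k³. Then h is well-defined (the series converges for every x ∈ (0,1)), h is strictly decreasing on (0,1), h is integrable on (0,1) with ∫₀¹ h(x) dx = ∑_{k=1}^∞ 1/k² < ∞, but for every p > 1 one has ∫₀¹ h(x)^p dx = ∞. -/
open MeasureTheory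

noncomputable section

/-- `hSer x = ∑_{k=1}^∞ x^{1/k - 1} / k³` (the index `k : ℕ` below stands for `k+1 ≥ 1`). -/
def hSer (x : ℝ) : ℝ :=
  ∑' k : ℕ, x ^ ((1 : ℝ) / (k + 1) - 1) / ((k : ℝ) + 1) ^ 3

lemma hSer_term_nonneg {x : ℝ} (hx : 0 ≤ x) (k : ℕ) :
    0 ≤ x ^ ((1 : ℝ) / (k + 1) - 1) / ((k : ℝ) + 1) ^ 3 := by
  positivity

lemma summable_one_div_succ_pow {n : ℕ} (hn : 1 < n) :
    Summable fun k : ℕ => 1 / ((k : ℝ) + 1) ^ n := by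
  have h := (summable_nat_add_iff 1).2 (Real.summable_one_div_nat_pow.2 hn)
  simpa using h

lemma summable_hSer_term {x : ℝ} (hx : x ∈ Set.Ioo (0 : ℝ) 1) :
    Summable fun k : ℕ => x ^ ((1 : ℝ) / (k + 1) - 1) / ((k : ℝ) + 1) ^ 3 := by
  refine Summable.of_nonneg_of_le (hSer_term_nonneg hx.1.le) (fun k => ?_)
    ((summable_one_div_succ_pow (n := 3) (by norm_num)).mul_left (x ^ (-1 : ℝ)))
  rw [mul_one_div]
  gcongr ?_ / _
  refine Real.rpow_le_rpow_of_exponent_ge hx.1 hx.2.le ?_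
  have : (0 : ℝ) ≤ 1 / (k + 1) := by positivity
  linarith

lemma strictAntiOn_hSer : StrictAntiOn hSer (Set.Ioo (0 : ℝ) 1) := by
  intro x hx y hy hxy
  refine (summable_hSer_term hy).tsum_lt_tsum (i := 1) (fun k => ?_) ?_ (summable_hSer_term hx)
  · have hk : (1 : ℝ) / (k + 1) - 1 ≤ 0 := by
      rw [sub_nonpos, div_le_one (by positivity)]
      simp
    exact div_le_div_of_nonneg_right (Real.rpow_le_rpow_of_nonpos hx.1 hxy.le hk) (by positivity)
  · exact div_lt_div_of_pos_right (Real.rpow_lt_rpow_of_neg hx.1 hxy (by norm_num)) (by positivity)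

lemma neg_one_lt_hSer_exponent (k : ℕ) : -1 < (1 : ℝ) / (k + 1) - 1 := by
  have : (0 : ℝ) < 1 / (k + 1) := by positivity
  linarith

lemma integrableOn_hSer_term (k : ℕ) :
    IntegrableOn (fun x : ℝ => x ^ ((1 : ℝ) / (k + 1) - 1) / ((k : ℝ) + 1) ^ 3)
      (Set.Ioo 0 1) :=
  ((intervalIntegral.integrableOn_Ioo_rpow_iff one_pos).2
    (neg_one_lt_hSer_exponent k)).div_const _

lemma integral_hSer_term (k : ℕ) :
    ∫ x in Set.Ioo (0 : ℝ) 1, x ^ ((1 : ℝ) / (k + 1) - 1) / ((k : ℝ) + 1) ^ 3 =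
      1 / ((k : ℝ) + 1) ^ 2 := by
  have hk : (k : ℝ) + 1 ≠ 0 := by positivity
  rw [← integral_Ioc_eq_integral_Ioo, ← intervalIntegral.integral_of_le zero_le_one,
    intervalIntegral.integral_div, integral_rpow (Or.inl (neg_one_lt_hSer_exponent k)),
    sub_add_cancel, Real.one_rpow, Real.zero_rpow (one_div_ne_zero hk)]
  field_simp
  ring

lemma integral_hSer :
    ∫ x in Set.Ioo (0 : ℝ) 1, hSer x = ∑' k : ℕ, 1 / ((k : ℝ) + 1) ^ 2 := by
  have hnorm (k : ℕ) :
      ∫ x in Set.Ioo (0 : ℝ) 1, ‖x ^ ((1 : ℝ) / (k + 1) - 1) / ((k : ℝ) + 1) ^ 3‖ =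
        1 / ((k : ℝ) + 1) ^ 2 := by
    rw [← integral_hSer_term k]
    exact setIntegral_congr_fun measurableSet_Ioo fun x hx =>
      Real.norm_of_nonneg (hSer_term_nonneg hx.1.le k)
  have h := hasSum_integral_of_summable_integral_norm integrableOn_hSer_term
    (by simpa only [hnorm] using summable_one_div_succ_pow (n := 2) (by norm_num))
  simp only [integral_hSer_term] at h
  exact h.tsum_eq.symm

lemma integrableOn_hSer : IntegrableOn hSer (Set.Ioo (0 : ℝ) 1) := by
  refine Integrable.of_integral_ne_zero ?_
  rw [integral_hSer]
  exact ((summable_one_div_succ_pow (n := 2) (by norm_num)).tsum_pos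
    (fun k => by positivity) 0 (by norm_num)).ne'

lemma lintegral_hSer_rpow {p : ℝ} (hp : 1 < p) :
    ∫⁻ x in Set.Ioo (0 : ℝ) 1, ENNReal.ofReal (hSer x ^ p) = ⊤ := by
  obtain ⟨k, hk⟩ := exists_nat_one_div_lt (show 0 < 1 - 1 / p by
    rw [sub_pos, div_lt_one (by linarith)]; exact hp)
  have hs : ((1 : ℝ) / (k + 1) - 1) * p ≤ -1 := by
    have h : ((1 : ℝ) / (k + 1) - 1) * p ≤ (-(1 / p)) * p := by
      gcongr
      linarith
    rwa [neg_mul, one_div_mul_cancel (by linarith)] at h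
  have hK : (0 : ℝ) < (((k : ℝ) + 1) ^ 3) ^ p := by positivity
  by_contra htop
  have hle : ∫⁻ x in Set.Ioo (0 : ℝ) 1,
      ENNReal.ofReal (x ^ (((1 : ℝ) / (k + 1) - 1) * p) / (((k : ℝ) + 1) ^ 3) ^ p) ≤
      ∫⁻ x in Set.Ioo (0 : ℝ) 1, ENNReal.ofReal (hSer x ^ p) := by
    refine setLIntegral_mono' measurableSet_Ioo fun x hx => ENNReal.ofReal_le_ofReal ?_
    rw [Real.rpow_mul hx.1.le, ← Real.div_rpow (Real.rpow_nonneg hx.1.le _) (by positivity)]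
    exact Real.rpow_le_rpow (hSer_term_nonneg hx.1.le k)
      ((summable_hSer_term hx).le_tsum k fun j _ => hSer_term_nonneg hx.1.le j) (by linarith)
  have hint : IntegrableOn
      (fun x : ℝ => x ^ (((1 : ℝ) / (k + 1) - 1) * p) / (((k : ℝ) + 1) ^ 3) ^ p)
      (Set.Ioo 0 1) := by
    refine (lintegral_ofReal_ne_top_iff_integrable
      (by fun_prop) ?_).1 (ne_top_of_le_ne_top htop hle)
    filter_upwards [ae_restrict_mem measurableSet_Ioo] with x hx
    exact div_nonneg (Real.rpow_nonneg hx.1.le _) hK.le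
  have hint' := hint.mul_const ((((k : ℝ) + 1) ^ 3) ^ p)
  simp only [div_mul_cancel₀ _ hK.ne'] at hint'
  exact hs.not_gt ((intervalIntegral.integrableOn_Ioo_rpow_iff one_pos).1 hint')

/-- the series defining `hSer` converges on `(0,1)`, `hSer` is strictly
decreasing on `(0,1)`, integrable on `(0,1)` with `∫₀¹ hSer = ∑ 1/k² < ∞`, but
`∫₀¹ hSer^p = ∞` for every `p > 1`. -/
theorem hSer_properties :
    (∀ x ∈ Set.Ioo (0 : ℝ) 1,
      Summable fun k : ℕ => x ^ ((1 : ℝ) / (k + 1) - 1) / ((k : ℝ) + 1) ^ 3) ∧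
    StrictAntiOn hSer (Set.Ioo (0 : ℝ) 1) ∧
    (Summable fun k : ℕ => 1 / ((k : ℝ) + 1) ^ 2) ∧
    IntegrableOn hSer (Set.Ioo (0 : ℝ) 1) ∧
    (∫ x in Set.Ioo (0 : ℝ) 1, hSer x) = ∑' k : ℕ, 1 / ((k : ℝ) + 1) ^ 2 ∧
    (∀ p : ℝ, 1 < p →
      (∫⁻ x in Set.Ioo (0 : ℝ) 1, ENNReal.ofReal (hSer x ^ p)) = ⊤) := by
  exact ⟨fun _ => summable_hSer_term, strictAntiOn_hSer,
    summable_one_div_succ_pow (by norm_num), integrableOn_hSer, integral_hSer,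
    fun _ => lintegral_hSer_rpow⟩
end
end
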